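/- arXiv:2406.16387 — 4 statements merged into one kernel-verified Lean document; each statement's English description precedes it below -/
import Mathlib

section
/- Let A be a finite totally ordered alphabet, W ∈ A* a word, a ∈ A a letter, and i ≥ 1 with |W|_a ≥ i. Let W' be the (a,i)-expansion of W. Let G be the lexicographically largest gathered word in the ≡_{Sylv(A)}-class of W, and let G' be the lexicographically largest gathered word in the ≡_{Sylv(A)}-class of W'. Then G' equals the (a,i)-expansion of G. (That is, the sylvester monoid satisfies condition (b) of being of type 2.) -/
/-- The defining relations of the sylvester monoid: `a·c·W·b = c·a·W·b`
for all letters `a ≤ b < c` and all words `W`. -/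
def sylvRel {A : Type*} [LinearOrder A] (U V : FreeMonoid A) : Prop :=
  ∃ (a b c : A) (W : FreeMonoid A), a ≤ b ∧ b < c ∧
    U = FreeMonoid.of a * FreeMonoid.of c * W * FreeMonoid.of b ∧
    V = FreeMonoid.of c * FreeMonoid.of a * W * FreeMonoid.of b

/-- The congruence on the free monoid defining the sylvester monoid `Sylv(A)`. -/
def sylvCon (A : Type*) [LinearOrder A] : Con (FreeMonoid A) :=
  conGen sylvRel

/-- A word `W` is gathered (w.r.t. the sylvester monoid) if for every word `W'`
equivalent to `W` and every factorization `W' = U'·a·a·V'`, there is a factorization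
`W = U·a·a·V` in which `U` has the same number of occurrences of `a` as `U'`. -/
def Gathered {A : Type*} [LinearOrder A] (W : FreeMonoid A) : Prop :=
  ∀ (W' U' V' : FreeMonoid A) (a : A),
    sylvCon A W' W → W' = U' * FreeMonoid.of a * FreeMonoid.of a * V' →
    ∃ U V : FreeMonoid A,
      W = U * FreeMonoid.of a * FreeMonoid.of a * V ∧
      U.toList.count a = U'.toList.count a

/-- `W'` is the `(a,i)`-expansion of `W`: the word obtained from `W` by duplicating
the `i`-th occurrence (from the left) of the letter `a`. -/
def IsExpansion {A : Type*} [LinearOrder A] (a : A) (i : ℕ) (W W' : FreeMonoid A) : Prop :=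
  ∃ P S : FreeMonoid A, P.toList.count a = i - 1 ∧
    W = P * FreeMonoid.of a * S ∧
    W' = P * FreeMonoid.of a * FreeMonoid.of a * S

/-- `G` is the lexicographically largest gathered word in the
`≡_{Sylv(A)}`-equivalence class of `W`. -/
def IsMaxGathered {A : Type*} [LinearOrder A] (W G : FreeMonoid A) : Prop :=
  sylvCon A G W ∧ Gathered G ∧
    ∀ G' : FreeMonoid A, sylvCon A G' W → Gathered G' →
      G' = G ∨ List.Lex (· < ·) G'.toList G.toList

namespace Sylvester

variable {A : Type*} [LinearOrder A]

/-- One elementary sylvester move: two adjacent letters `x < c` are exchanged, a letter in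
`[x, c)` occurring further to the right. -/
inductive Step : List A → List A → Prop
  | swap (x c : A) (r : List A) (h : ∃ y ∈ r, x ≤ y ∧ y < c) : Step (x :: c :: r) (c :: x :: r)
  | cons (z : A) {u v : List A} (h : Step u v) : Step (z :: u) (z :: v)

/-- Sylvester equivalence of words, generated by elementary moves. -/
abbrev Equiv (u v : List A) : Prop := Relation.EqvGen Step u v

theorem Step.append_left (p : List A) {u v : List A} (h : Step u v) :
    Step (p ++ u) (p ++ v) := by
  induction p with
  | nil => exact h
  | cons z p ih => exact .cons z ih

theorem Step.append_right (q : List A) {u v : List A} (h : Step u v) :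
    Step (u ++ q) (v ++ q) := by
  induction h with
  | swap x c r h =>
    obtain ⟨y, hy, h⟩ := h
    exact .swap x c (r ++ q) ⟨y, List.mem_append_left _ hy, h⟩
  | cons z _ ih => exact .cons z ih

theorem Step.perm {u v : List A} (h : Step u v) : u.Perm v := by
  induction h with
  | swap x c r _ => exact .swap _ _ _
  | cons z _ ih => exact .cons z ih

theorem Equiv.map {f : List A → List A} (hf : ∀ u v, Step u v → Equiv (f u) (f v))
    {u v : List A} (h : Equiv u v) : Equiv (f u) (f v) := by
  induction h with
  | rel u v h => exact hf u v h
  | refl u => exact .refl _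
  | symm u v _ ih => exact .symm _ _ ih
  | trans u v w _ _ ih₁ ih₂ => exact .trans _ _ _ ih₁ ih₂

theorem Equiv.append_left (p : List A) {u v : List A} (h : Equiv u v) :
    Equiv (p ++ u) (p ++ v) :=
  h.map fun _ _ h => .rel _ _ (h.append_left p)

theorem Equiv.append_right (q : List A) {u v : List A} (h : Equiv u v) :
    Equiv (u ++ q) (v ++ q) :=
  h.map (f := (· ++ q)) fun _ _ h => .rel _ _ (h.append_right q)

theorem Equiv.eq_of_step {α : Type*} {f : List A → α} (hf : ∀ u v, Step u v → f u = f v)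
    {u v : List A} (h : Equiv u v) : f u = f v := by
  induction h with
  | rel u v h => exact hf u v h
  | refl u => rfl
  | symm u v _ ih => exact ih.symm
  | trans u v w _ _ ih₁ ih₂ => exact ih₁.trans ih₂

theorem Equiv.count_eq (a : A) {u v : List A} (h : Equiv u v) : u.count a = v.count a :=
  h.eq_of_step fun _ _ h => h.perm.count_eq a

theorem Step.sylvCon {u v : List A} (h : Step u v) :
    sylvCon A (FreeMonoid.ofList u) (FreeMonoid.ofList v) := by
  induction h with
  | swap x c r h =>
    obtain ⟨y, hy, hxy, hyc⟩ := h
    obtain ⟨w, q, rfl⟩ := List.append_of_mem hy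
    have h₁ : _root_.sylvCon A
        (FreeMonoid.of x * FreeMonoid.of c * FreeMonoid.ofList w * FreeMonoid.of y)
        (FreeMonoid.of c * FreeMonoid.of x * FreeMonoid.ofList w * FreeMonoid.of y) :=
      ConGen.Rel.of _ _ ⟨x, y, c, FreeMonoid.ofList w, hxy, hyc, rfl, rfl⟩
    have h₂ := (_root_.sylvCon A).mul h₁ ((_root_.sylvCon A).refl (FreeMonoid.ofList q))
    simp only [mul_assoc] at h₂
    exact h₂
  | cons z _ ih => exact (_root_.sylvCon A).mul ((_root_.sylvCon A).refl (FreeMonoid.of z)) ih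

theorem sylvCon_iff (U V : FreeMonoid A) : sylvCon A U V ↔ Equiv U.toList V.toList := by
  constructor
  · intro h
    induction h with
    | of U V h =>
      obtain ⟨a, b, c, W, hab, hbc, rfl, rfl⟩ := h
      refine .rel _ _ ?_
      simpa using Step.swap a c (W.toList ++ [b]) ⟨b, by simp, hab, hbc⟩
    | refl U => exact .refl _
    | symm _ ih => exact .symm _ _ ih
    | trans _ _ ih₁ ih₂ => exact .trans _ _ _ ih₁ ih₂
    | mul _ _ ih₁ ih₂ =>
      simp only [FreeMonoid.toList_mul]
      exact .trans _ _ _ (ih₁.append_right _) (ih₂.append_left _)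
  · intro h
    suffices ∀ u v : List A, Equiv u v →
        sylvCon A (FreeMonoid.ofList u) (FreeMonoid.ofList v) from this _ _ h
    intro u v h
    induction h with
    | rel u v h => exact h.sylvCon
    | refl u => exact (sylvCon A).refl _
    | symm u v _ ih => exact (sylvCon A).symm ih
    | trans u v w _ _ ih₁ ih₂ => exact (sylvCon A).trans ih₁ ih₂

/-- Duplicate the occurrence of `a` preceded by exactly `i` occurrences of `a`. -/
def dup (a : A) : ℕ → List A → List A
  | _, [] => []
  | i, x :: l =>
    if x = a then
      match i with
      | 0 => a :: a :: l
      | i + 1 => a :: dup a i l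
    else x :: dup a i l

/-- Delete the occurrence of `a` preceded by exactly `i` occurrences of `a`. -/
def del (a : A) : ℕ → List A → List A
  | _, [] => []
  | i, x :: l =>
    if x = a then
      match i with
      | 0 => l
      | i + 1 => a :: del a i l
    else x :: del a i l

@[simp] theorem dup_nil (a : A) (i : ℕ) : dup a i [] = [] := by
  cases i <;> rfl

@[simp] theorem dup_cons_self_zero (a : A) (l : List A) : dup a 0 (a :: l) = a :: a :: l := by
  simp [dup]

@[simp] theorem dup_cons_self_succ (a : A) (i : ℕ) (l : List A) :
    dup a (i + 1) (a :: l) = a :: dup a i l := by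
  simp [dup]

theorem dup_cons_of_ne {a x : A} (h : x ≠ a) (i : ℕ) (l : List A) :
    dup a i (x :: l) = x :: dup a i l := by
  cases i <;> simp [dup, h]

@[simp] theorem del_nil (a : A) (i : ℕ) : del a i [] = [] := by
  cases i <;> rfl

@[simp] theorem del_cons_self_zero (a : A) (l : List A) : del a 0 (a :: l) = l := by
  simp [del]

@[simp] theorem del_cons_self_succ (a : A) (i : ℕ) (l : List A) :
    del a (i + 1) (a :: l) = a :: del a i l := by
  simp [del]

theorem del_cons_of_ne {a x : A} (h : x ≠ a) (i : ℕ) (l : List A) :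
    del a i (x :: l) = x :: del a i l := by
  cases i <;> simp [del, h]

theorem dup_append_of_lt {a : A} {i : ℕ} {u : List A} (h : i < u.count a) (v : List A) :
    dup a i (u ++ v) = dup a i u ++ v := by
  induction u generalizing i with
  | nil => simp at h
  | cons x u ih =>
    by_cases hx : x = a
    · subst hx
      cases i with
      | zero => simp
      | succ i => simp [ih (i := i) (by simpa using h)]
    · simp [dup_cons_of_ne hx, ih (i := i) (by simpa [hx] using h)]

theorem dup_append_add (a : A) (u : List A) (j : ℕ) (v : List A) :
    dup a (u.count a + j) (u ++ v) = u ++ dup a j v := by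
  induction u with
  | nil => simp
  | cons x u ih =>
    by_cases hx : x = a
    · subst hx
      simp [Nat.add_right_comm _ 1 j, ih]
    · simp [dup_cons_of_ne hx, ih, hx]

theorem del_append_of_lt {a : A} {i : ℕ} {u : List A} (h : i < u.count a) (v : List A) :
    del a i (u ++ v) = del a i u ++ v := by
  induction u generalizing i with
  | nil => simp at h
  | cons x u ih =>
    by_cases hx : x = a
    · subst hx
      cases i with
      | zero => simp
      | succ i => simp [ih (i := i) (by simpa using h)]
    · simp [del_cons_of_ne hx, ih (i := i) (by simpa [hx] using h)]

theorem del_append_add (a : A) (u : List A) (j : ℕ) (v : List A) :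
    del a (u.count a + j) (u ++ v) = u ++ del a j v := by
  induction u with
  | nil => simp
  | cons x u ih =>
    by_cases hx : x = a
    · subst hx
      simp [Nat.add_right_comm _ 1 j, ih]
    · simp [del_cons_of_ne hx, ih, hx]

theorem del_dup (a : A) (i : ℕ) (l : List A) (h : i < l.count a) : del a i (dup a i l) = l := by
  induction l generalizing i with
  | nil => simp
  | cons x l ih =>
    by_cases hx : x = a
    · subst hx
      cases i with
      | zero => simp
      | succ i => simp [ih i (by simpa using h)]
    · simp [dup_cons_of_ne hx, del_cons_of_ne hx, ih i (by simpa [hx] using h)]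

theorem del_succ_dup (a : A) (i : ℕ) (l : List A) (h : i < l.count a) :
    del a (i + 1) (dup a i l) = l := by
  induction l generalizing i with
  | nil => simp
  | cons x l ih =>
    by_cases hx : x = a
    · subst hx
      cases i with
      | zero => simp
      | succ i => simp [ih i (by simpa using h)]
    · simp [dup_cons_of_ne hx, del_cons_of_ne hx, ih i (by simpa [hx] using h)]

theorem count_dup_self {a : A} {i : ℕ} {l : List A} (h : i < l.count a) :
    (dup a i l).count a = l.count a + 1 := by
  induction l generalizing i with
  | nil => simp at h
  | cons x l ih =>
    by_cases hx : x = a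
    · subst hx
      cases i with
      | zero => simp
      | succ i => simp [ih (i := i) (by simpa using h)]
    · simp [dup_cons_of_ne hx, ih (i := i) (by simpa [hx] using h), hx]

theorem count_del_self {a : A} {i : ℕ} {l : List A} (h : i < l.count a) :
    (del a i l).count a + 1 = l.count a := by
  induction l generalizing i with
  | nil => simp at h
  | cons x l ih =>
    by_cases hx : x = a
    · subst hx
      cases i with
      | zero => simp
      | succ i => simp [ih (i := i) (by simpa using h)]
    · simp [del_cons_of_ne hx, ih (i := i) (by simpa [hx] using h), hx]

theorem count_dup_of_ne {a x : A} (hxa : x ≠ a) (i : ℕ) (l : List A) :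
    (dup a i l).count x = l.count x := by
  induction l generalizing i with
  | nil => simp
  | cons z l ih =>
    by_cases hz : z = a
    · subst hz
      cases i <;> simp [hxa.symm, ih]
    · simp [dup_cons_of_ne hz, List.count_cons, ih]

theorem count_del_of_ne {a x : A} (hxa : x ≠ a) (i : ℕ) (l : List A) :
    (del a i l).count x = l.count x := by
  induction l generalizing i with
  | nil => simp
  | cons z l ih =>
    by_cases hz : z = a
    · subst hz
      cases i <;> simp [hxa.symm, ih]
    · simp [del_cons_of_ne hz, List.count_cons, ih]

theorem subset_dup (a : A) (i : ℕ) (l : List A) : l ⊆ dup a i l := by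
  induction l generalizing i with
  | nil => simp
  | cons z l ih =>
    by_cases hz : z = a
    · subst hz
      cases i with
      | zero => simp
      | succ i =>
        rw [dup_cons_self_succ]
        exact List.cons_subset_cons _ (ih i)
    · rw [dup_cons_of_ne hz]
      exact List.cons_subset_cons _ (ih i)

theorem mem_del {a : A} {i : ℕ} {l : List A} (h : i + 1 < l.count a) {y : A} (hy : y ∈ l) :
    y ∈ del a i l := by
  rw [← List.count_pos_iff] at hy ⊢
  by_cases hya : y = a
  · subst hya
    have := count_del_self (a := y) (i := i) (l := l) (by omega)
    omega
  · rwa [count_del_of_ne hya]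

theorem Step.dup (a : A) (i : ℕ) {u v : List A} (h : Step u v) :
    Equiv (dup a i u) (dup a i v) := by
  induction h generalizing i with
  | swap x c r h =>
    obtain ⟨y, hy, hxy, hyc⟩ := h
    have hxc : x < c := hxy.trans_lt hyc
    have key : ∀ r' : List A, r ⊆ r' → Step (x :: c :: r') (c :: x :: r') :=
      fun r' h => .swap x c r' ⟨y, h hy, hxy, hyc⟩
    by_cases hx : x = a
    · subst hx
      cases i with
      | zero =>
        simp only [dup_cons_self_zero, dup_cons_of_ne hxc.ne']
        exact .trans _ _ _ (.rel _ _ (.cons x (key r (List.Subset.refl r))))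
          (.rel _ _ (key _ (List.subset_cons_self _ _)))
      | succ i =>
        simp only [dup_cons_self_succ, dup_cons_of_ne hxc.ne']
        exact .rel _ _ (key _ (subset_dup x i r))
    · by_cases hc : c = a
      · subst hc
        cases i with
        | zero =>
          simp only [dup_cons_self_zero, dup_cons_of_ne hx]
          exact .trans _ _ _ (.rel _ _ (key _ (List.subset_cons_self _ _)))
            (.rel _ _ (.cons c (key r (List.Subset.refl r))))
        | succ i =>
          simp only [dup_cons_self_succ, dup_cons_of_ne hx]
          exact .rel _ _ (key _ (subset_dup c i r))
      · simp only [dup_cons_of_ne hx, dup_cons_of_ne hc]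
        exact .rel _ _ (key _ (subset_dup a i r))
  | @cons z u v h ih =>
    by_cases hz : z = a
    · subst hz
      cases i with
      | zero =>
        simp only [dup_cons_self_zero]
        exact .rel _ _ (.cons _ (.cons _ h))
      | succ i =>
        simp only [dup_cons_self_succ]
        exact (ih i).append_left [z]
    · simp only [dup_cons_of_ne hz]
      exact (ih i).append_left [z]

theorem Equiv.dup (a : A) (i : ℕ) {u v : List A} (h : Equiv u v) :
    Equiv (dup a i u) (dup a i v) :=
  h.map fun _ _ h => h.dup a i

theorem Step.del {a : A} {i : ℕ} {u v : List A} (h : Step u v) (hi : i + 1 < u.count a) :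
    Equiv (del a i u) (del a i v) := by
  induction h generalizing i with
  | swap x c r h =>
    obtain ⟨y, hy, hxy, hyc⟩ := h
    have hxc : x < c := hxy.trans_lt hyc
    have key : ∀ r' : List A, y ∈ r' → Step (x :: c :: r') (c :: x :: r') :=
      fun r' h => .swap x c r' ⟨y, h, hxy, hyc⟩
    by_cases hx : x = a
    · subst hx
      cases i with
      | zero =>
        simp only [del_cons_self_zero, del_cons_of_ne hxc.ne']
        exact .refl _
      | succ i =>
        simp only [del_cons_self_succ, del_cons_of_ne hxc.ne']
        exact .rel _ _ (key _ (mem_del (by simpa [hxc.ne'] using hi) hy))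
    · by_cases hc : c = a
      · subst hc
        cases i with
        | zero =>
          simp only [del_cons_self_zero, del_cons_of_ne hx]
          exact .refl _
        | succ i =>
          simp only [del_cons_self_succ, del_cons_of_ne hx]
          exact .rel _ _ (key _ (mem_del (by simpa [hx] using hi) hy))
      · simp only [del_cons_of_ne hx, del_cons_of_ne hc]
        exact .rel _ _ (key _ (mem_del (by simpa [hx, hc] using hi) hy))
  | @cons z u v h ih =>
    by_cases hz : z = a
    · subst hz
      cases i with
      | zero =>
        simp only [del_cons_self_zero]
        exact .rel _ _ h
      | succ i =>
        simp only [del_cons_self_succ]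
        exact (ih (by simpa using hi)).append_left [z]
    · simp only [del_cons_of_ne hz]
      exact (ih (by simpa [hz] using hi)).append_left [z]

theorem Equiv.del {a : A} {i : ℕ} {u v : List A} (h : Equiv u v) (hi : i + 1 < u.count a) :
    Equiv (del a i u) (del a i v) := by
  induction h with
  | rel u v h => exact h.del hi
  | refl u => exact .refl _
  | symm u v h ih => exact .symm _ _ (ih (by rwa [Equiv.count_eq a h]))
  | trans u v w h _ ih₁ ih₂ =>
    exact .trans _ _ _ (ih₁ hi) (ih₂ (by rwa [← Equiv.count_eq a h]))

/-- Some occurrence of `x` preceded by exactly `k` occurrences of `x` is immediately followed by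
another `x`. -/
def Adj (x : A) (k : ℕ) (l : List A) : Prop :=
  ∃ U V : List A, l = U ++ x :: x :: V ∧ U.count x = k

theorem Adj.dup_of_ne {a x : A} {k : ℕ} {l : List A} (hxa : x ≠ a) (i : ℕ) (h : Adj x k l) :
    Adj x k (dup a i l) := by
  obtain ⟨U, V, rfl, rfl⟩ := h
  rcases lt_or_ge i (U.count a) with hi | hi
  · exact ⟨_, _, dup_append_of_lt hi _, count_dup_of_ne hxa i U⟩
  · obtain ⟨j, rfl⟩ := Nat.exists_eq_add_of_le hi
    exact ⟨U, dup a j V, by simp [dup_append_add, dup_cons_of_ne hxa], rfl⟩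

theorem Adj.del_of_ne {a x : A} {k : ℕ} {l : List A} (hxa : x ≠ a) (i : ℕ) (h : Adj x k l) :
    Adj x k (del a i l) := by
  obtain ⟨U, V, rfl, rfl⟩ := h
  rcases lt_or_ge i (U.count a) with hi | hi
  · exact ⟨_, _, del_append_of_lt hi _, count_del_of_ne hxa i U⟩
  · obtain ⟨j, rfl⟩ := Nat.exists_eq_add_of_le hi
    exact ⟨U, del a j V, by simp [del_append_add, del_cons_of_ne hxa], rfl⟩

theorem Adj.dup_of_lt {a : A} {k i : ℕ} {l : List A} (hki : k < i) (h : Adj a k l) :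
    Adj a k (dup a i l) := by
  obtain ⟨U, V, rfl, rfl⟩ := h
  obtain ⟨j, rfl⟩ := Nat.exists_eq_add_of_lt hki
  rw [Nat.add_assoc, dup_append_add, dup_cons_self_succ]
  cases j with
  | zero => exact ⟨U, a :: V, by simp, rfl⟩
  | succ j => exact ⟨U, dup a j V, by simp, rfl⟩

theorem Adj.dup_of_le {a : A} {k i : ℕ} {l : List A} (hik : i ≤ k) (h : Adj a k l) :
    Adj a (k + 1) (dup a i l) := by
  obtain ⟨U, V, rfl, rfl⟩ := h
  rcases hik.lt_or_eq with hi | rfl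
  · exact ⟨_, _, dup_append_of_lt hi _, count_dup_self hi⟩
  · refine ⟨U ++ [a], V, ?_, by simp⟩
    simpa using dup_append_add a U 0 (a :: a :: V)

theorem Adj.del_of_lt {a : A} {k i : ℕ} {l : List A} (hki : k + 1 < i) (h : Adj a k l) :
    Adj a k (del a i l) := by
  obtain ⟨U, V, rfl, rfl⟩ := h
  obtain ⟨j, rfl⟩ := Nat.exists_eq_add_of_lt hki
  refine ⟨U, del a j V, ?_, rfl⟩
  rw [show U.count a + 1 + j + 1 = U.count a + (j + 1 + 1) by omega, del_append_add,
    del_cons_self_succ, del_cons_self_succ]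

theorem Adj.del_of_le {a : A} {k i : ℕ} {l : List A} (hik : i ≤ k) (h : Adj a (k + 1) l) :
    Adj a k (del a i l) := by
  obtain ⟨U, V, rfl, hk⟩ := h
  have hi : i < U.count a := by omega
  have := count_del_self hi
  exact ⟨_, _, del_append_of_lt hi _, by omega⟩

theorem exists_eq_append_of_lt_count {a : A} {i : ℕ} {l : List A} (h : i < l.count a) :
    ∃ U V : List A, l = U ++ a :: V ∧ U.count a = i := by
  induction l generalizing i with
  | nil => simp at h
  | cons x l ih =>
    by_cases hx : x = a
    · subst hx
      cases i with
      | zero => exact ⟨[], l, rfl, rfl⟩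
      | succ i =>
        obtain ⟨U, V, rfl, rfl⟩ := ih (i := i) (by simpa using h)
        exact ⟨x :: U, V, rfl, by simp⟩
    · obtain ⟨U, V, rfl, hU⟩ := ih (i := i) (by simpa [hx] using h)
      exact ⟨x :: U, V, rfl, by simpa [hx] using hU⟩

theorem dup_append_cons {a : A} {i : ℕ} {U : List A} (hU : U.count a = i) (V : List A) :
    dup a i (U ++ a :: V) = U ++ a :: a :: V := by
  subst hU
  simpa using dup_append_add a U 0 (a :: V)

theorem adj_dup_self {a : A} {i : ℕ} {l : List A} (h : i < l.count a) : Adj a i (dup a i l) := by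
  obtain ⟨U, V, rfl, hU⟩ := exists_eq_append_of_lt_count h
  exact ⟨U, V, dup_append_cons hU V, hU⟩

open Classical in
/-- The number of occurrences of `a` to the right of the last letter in `[b, a)`
(all occurrences if there is no such letter). -/
noncomputable def tailCount (b a : A) : List A → ℕ
  | [] => 0
  | x :: l => if ∃ y ∈ l, b ≤ y ∧ y < a then tailCount b a l else (x :: l).count a

theorem tailCount_cons_of_exists {b a : A} {l : List A} (h : ∃ y ∈ l, b ≤ y ∧ y < a) (x : A) :
    tailCount b a (x :: l) = tailCount b a l := if_pos h

theorem tailCount_cons_of_not_exists {b a : A} {l : List A} (h : ¬∃ y ∈ l, b ≤ y ∧ y < a) (x : A) :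
    tailCount b a (x :: l) = (x :: l).count a := if_neg h

theorem tailCount_append {b a : A} {l : List A} (h : ∃ y ∈ l, b ≤ y ∧ y < a) (p : List A) :
    tailCount b a (p ++ l) = tailCount b a l := by
  induction p with
  | nil => rfl
  | cons x p ih =>
    obtain ⟨y, hy, h⟩ := h
    rw [List.cons_append, tailCount_cons_of_exists ⟨y, List.mem_append_right _ hy, h⟩, ih]

theorem tailCount_le (b a : A) (l : List A) : tailCount b a l ≤ l.count a := by
  induction l with
  | nil => simp [tailCount]
  | cons x l ih =>
    by_cases h : ∃ y ∈ l, b ≤ y ∧ y < a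
    · rw [tailCount_cons_of_exists h]
      exact ih.trans List.count_le_count_cons
    · rw [tailCount_cons_of_not_exists h]

theorem count_le_tailCount_append {b a : A} {l : List A} (h : ¬∃ y ∈ l, b ≤ y ∧ y < a)
    (p : List A) : l.count a ≤ tailCount b a (p ++ l) := by
  induction p with
  | nil =>
    cases l with
    | nil => simp
    | cons x l =>
      rw [List.nil_append, tailCount_cons_of_not_exists]
      rintro ⟨y, hy, h'⟩
      exact h ⟨y, List.mem_cons_of_mem _ hy, h'⟩
  | cons x p ih =>
    by_cases h' : ∃ y ∈ p ++ l, b ≤ y ∧ y < a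
    · rwa [List.cons_append, tailCount_cons_of_exists h']
    · rw [List.cons_append, tailCount_cons_of_not_exists h', ← List.cons_append, List.count_append]
      omega

theorem Step.tailCount_eq (b a : A) {u v : List A} (h : Step u v) :
    tailCount b a u = tailCount b a v := by
  induction h with
  | swap x c r h =>
    obtain ⟨y, hy, hxy, hyc⟩ := h
    by_cases hr : ∃ z ∈ r, b ≤ z ∧ z < a
    · have hcons : ∀ w, ∃ z ∈ w :: r, b ≤ z ∧ z < a := fun w => by
        obtain ⟨z, hz, h⟩ := hr
        exact ⟨z, List.mem_cons_of_mem _ hz, h⟩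
      simp only [tailCount_cons_of_exists hr, tailCount_cons_of_exists (hcons _)]
    · by_cases hx : b ≤ x ∧ x < a
      · have hac : a ≤ y := not_lt.1 fun h => hr ⟨y, hy, hx.1.trans hxy, h⟩
        have hc : ¬∃ z ∈ c :: r, b ≤ z ∧ z < a := by
          rintro ⟨z, hz, h⟩
          rcases List.mem_cons.1 hz with rfl | hz
          · exact absurd h.2 (hac.trans hyc.le).not_gt
          · exact hr ⟨z, hz, h⟩
        rw [tailCount_cons_of_not_exists hc,
          tailCount_cons_of_exists ⟨x, List.mem_cons_self, hx⟩, tailCount_cons_of_not_exists hr]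
        simp [List.count_cons, (hac.trans_lt hyc).ne']
      · by_cases hc : b ≤ c ∧ c < a
        · have hxr : ¬∃ z ∈ x :: r, b ≤ z ∧ z < a := by simpa [hx] using hr
          rw [tailCount_cons_of_not_exists hxr,
            tailCount_cons_of_exists ⟨c, List.mem_cons_self, hc⟩, tailCount_cons_of_not_exists hr]
          simp [List.count_cons, ((hxy.trans_lt hyc).trans hc.2).ne]
        · rw [tailCount_cons_of_not_exists (by simpa [hc] using hr),
            tailCount_cons_of_not_exists (by simpa [hx] using hr)]
          exact (List.Perm.swap _ _ _).count_eq _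
  | @cons z u v h ih =>
    have hiff : (∃ y ∈ u, b ≤ y ∧ y < a) ↔ ∃ y ∈ v, b ≤ y ∧ y < a := by
      simp only [h.perm.mem_iff]
    by_cases hu : ∃ y ∈ u, b ≤ y ∧ y < a
    · rw [tailCount_cons_of_exists hu, tailCount_cons_of_exists (hiff.1 hu), ih]
    · rw [tailCount_cons_of_not_exists hu, tailCount_cons_of_not_exists (mt hiff.2 hu)]
      simp [List.count_cons, h.perm.count_eq]

theorem Equiv.tailCount_eq (b a : A) {u v : List A} (h : Equiv u v) :
    tailCount b a u = tailCount b a v :=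
  h.eq_of_step fun _ _ h => h.tailCount_eq b a

theorem equiv_shift {a : A} {Z V : List A} (ha : a ∉ Z)
    (hZ : ∀ b ∈ Z, b < a → ∃ y ∈ V, b ≤ y ∧ y < a) :
    Equiv (a :: (Z ++ a :: V)) (Z ++ a :: a :: V) := by
  induction Z with
  | nil => exact .refl _
  | cons z Z ih =>
    have ih := ih (fun h => ha (List.mem_cons_of_mem _ h))
      fun b hb => hZ b (List.mem_cons_of_mem _ hb)
    refine .trans _ _ _ ?_ (ih.append_left [z])
    have hza : z ≠ a := fun h => ha (h ▸ List.mem_cons_self)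
    rcases lt_or_gt_of_ne hza with h | h
    · obtain ⟨y, hy, h'⟩ := hZ z List.mem_cons_self h
      exact .symm _ _ (.rel _ _ (.swap z a _ ⟨y, by simp [hy], h'⟩))
    · exact .rel _ _ (.swap a z _ ⟨a, by simp, le_rfl, h⟩)

/-- If the occurrences number `k`, `k + 1` of `a` are adjacent in `X`, and the occurrences number
`k + 1`, `k + 2` are adjacent in a word equivalent to `X`, then after merging the latter two
the occurrences number `k`, `k + 1` can be made adjacent. -/
theorem exists_adj_of_adj_dup {a : A} {k : ℕ} {X G : List A} (hG : k + 1 < G.count a)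
    (hX : Equiv X (dup a (k + 1) G)) (h : Adj a k X) : ∃ Y, Equiv Y G ∧ Adj a k Y := by
  obtain ⟨U, R, rfl, rfl⟩ := h
  have hcount := hX.count_eq a
  rw [count_dup_self hG] at hcount
  simp only [List.count_append, List.count_cons_self] at hcount
  have hR : 0 < R.count a := by omega
  obtain ⟨Z, V, rfl, hZ⟩ := exists_eq_append_of_lt_count hR
  simp only [List.count_append, List.count_cons_self, hZ] at hcount
  obtain ⟨P, S, rfl, hP⟩ := exists_eq_append_of_lt_count hG
  simp only [List.count_append, List.count_cons_self, hP] at hcount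
  have hdel := hX.del (a := a) (i := U.count a + 1) (by simp; omega)
  rw [del_dup _ _ _ hG, del_append_add, del_cons_self_succ, del_cons_self_zero] at hdel
  rw [dup_append_cons hP] at hX
  have hlow : ∀ b ∈ Z, b < a → ∃ y ∈ V, b ≤ y ∧ y < a := by
    intro b hb hba
    by_contra hV
    have haV : ¬∃ y ∈ a :: V, b ≤ y ∧ y < a := by simpa using hV
    have hlower := count_le_tailCount_append haV (U ++ a :: a :: Z)
    have hupper := tailCount_le b a (Z ++ a :: V)
    rw [← tailCount_append ⟨b, by simp [hb], le_rfl, hba⟩ (U ++ [a, a])] at hupper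
    have htail := hX.tailCount_eq b a
    simp only [List.append_assoc, List.cons_append, List.nil_append, List.count_append,
      List.count_cons_self, hZ] at hlower hupper
    by_cases hS : ∃ y ∈ S, b ≤ y ∧ y < a
    · have hS' := tailCount_le b a S
      rw [← tailCount_append hS (P ++ [a, a])] at hS'
      simp only [List.append_assoc, List.cons_append, List.nil_append] at hS'
      omega
    · have haaS : ¬∃ y ∈ a :: a :: S, b ≤ y ∧ y < a := by simpa using hS
      have hS' := count_le_tailCount_append haaS P
      simp only [List.count_cons_self] at hS'
      omega
  refine ⟨_, .trans _ _ _ (.symm _ _ ?_) hdel, U ++ Z, V, rfl, by simp [hZ]⟩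
  simpa using (equiv_shift (List.count_eq_zero.1 hZ) hlow).append_left U

theorem lex_dup {a : A} {u v : List A} (h : List.Lex (· < ·) u v) (i : ℕ) :
    List.Lex (· < ·) (dup a i u) (dup a i v) := by
  induction h generalizing i with
  | @nil x l =>
    by_cases hx : x = a
    · subst hx
      cases i <;> simp
    · simp [dup_cons_of_ne hx]
  | @cons x l₁ l₂ h ih =>
    by_cases hx : x = a
    · subst hx
      cases i with
      | zero => simpa using h
      | succ i => simpa using ih i
    · simpa [dup_cons_of_ne hx] using ih i
  | @rel x l₁ y l₂ h =>
    have hhead : ∀ (z : A) (l : List A), ∃ l', dup a i (z :: l) = z :: l' := by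
      intro z l
      by_cases hz : z = a
      · subst hz
        cases i <;> simp
      · simp [dup_cons_of_ne hz]
    obtain ⟨l₁', h₁⟩ := hhead x l₁
    obtain ⟨l₂', h₂⟩ := hhead y l₂
    rw [h₁, h₂]
    exact .rel h

theorem gathered_iff (W : FreeMonoid A) :
    Gathered W ↔ ∀ (X : List A) (x : A) (k : ℕ), Equiv X W.toList → Adj x k X →
      Adj x k W.toList := by
  constructor
  · rintro h X x k hX ⟨U, V, rfl, rfl⟩
    obtain ⟨U', V', hW, hU'⟩ := h (FreeMonoid.ofList (U ++ x :: x :: V)) (FreeMonoid.ofList U)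
      (FreeMonoid.ofList V) x ((sylvCon_iff _ _).2 hX) (by simp [mul_assoc])
    exact ⟨U'.toList, V'.toList, by simp [hW], hU'⟩
  · rintro h W' U V x hW rfl
    obtain ⟨U', V', hW', hU'⟩ := h _ x _ ((sylvCon_iff _ _).1 hW)
      ⟨U.toList, V.toList, by simp, rfl⟩
    refine ⟨FreeMonoid.ofList U', FreeMonoid.ofList V', ?_, hU'⟩
    apply FreeMonoid.toList.injective
    simpa using hW'

theorem gathered_dup_iff {a : A} {i : ℕ} {G : List A} (hi : i < G.count a) :
    Gathered (FreeMonoid.ofList (dup a i G)) ↔ Gathered (FreeMonoid.ofList G) := by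
  simp only [gathered_iff, FreeMonoid.toList_ofList]
  constructor
  · intro h X x k hX hadj
    have key := fun k' => h (dup a i X) x k' (hX.dup a i)
    by_cases hxa : x = a
    · subst hxa
      rcases lt_or_ge k i with hk | hk
      · rw [← del_succ_dup x i G hi]
        exact (key k (hadj.dup_of_lt hk)).del_of_lt (by omega)
      · rw [← del_dup x i G hi]
        exact (key (k + 1) (hadj.dup_of_le hk)).del_of_le hk
    · rw [← del_dup a i G hi]
      exact (key k (hadj.dup_of_ne hxa i)).del_of_ne hxa i
  · intro h X x k hX hadj
    have hcount := hX.count_eq a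
    rw [count_dup_self hi] at hcount
    have hdel := hX.del (a := a) (i := i) (by omega)
    rw [del_dup _ _ _ hi] at hdel
    by_cases hxa : x = a
    · subst hxa
      rcases lt_trichotomy k i with hk | rfl | hk
      · rcases (Nat.succ_le_of_lt hk).lt_or_eq with hk' | rfl
        · exact (h _ x k hdel (hadj.del_of_lt hk')).dup_of_lt hk
        · obtain ⟨Y, hY, hYadj⟩ := exists_adj_of_adj_dup hi hX hadj
          exact (h Y x k hY hYadj).dup_of_lt hk
      · exact adj_dup_self hi
      · obtain ⟨k, rfl⟩ := Nat.exists_eq_add_of_lt hk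
        exact (h _ x _ hdel (hadj.del_of_le (by omega))).dup_of_le (by omega)
    · exact (h _ x k hdel (hadj.del_of_ne hxa i)).dup_of_ne hxa i

end Sylvester

open Sylvester
/-- The sylvester monoid satisfies condition (b) of being of type 2: taking the
`(a,i)`-expansion commutes with taking the lexicographically largest gathered word
of an `≡_{Sylv(A)}`-class. -/
theorem sylvester_type2_expansion {A : Type*} [LinearOrder A] [Fintype A]
    (W W' G G' : FreeMonoid A) (a : A) (i : ℕ)
    (hi : 1 ≤ i) (hia : i ≤ W.toList.count a)
    (hW' : IsExpansion a i W W')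
    (hG : IsMaxGathered W G) (hG' : IsMaxGathered W' G') :
    IsExpansion a i G G' := by
  obtain ⟨P, S, hP, rfl, rfl⟩ := hW'
  obtain ⟨hGW, hGg, hGmax⟩ := hG
  obtain ⟨hGW', hGg', hGmax'⟩ := hG'
  rw [sylvCon_iff] at hGW hGW'
  simp only [FreeMonoid.toList_mul, FreeMonoid.toList_of, List.append_assoc,
    List.cons_append, List.nil_append] at hGW hGW'
  obtain ⟨U, V, hUV, hU⟩ := (gathered_iff G').1 hGg' _ a (i - 1) (.symm _ _ hGW')
    ⟨P.toList, S.toList, rfl, hP⟩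
  have hdupW := dup_append_cons hP S.toList
  have hdupH := dup_append_cons hU V
  set H : List A := U ++ a :: V with hH
  have hHi : i - 1 < H.count a := by simp [hH, hU]
  have hWi : i - 1 < (P.toList ++ a :: S.toList).count a := by simp [hP]
  have hGi : i - 1 < G.toList.count a := by rwa [hGW.count_eq a]
  have hGH : FreeMonoid.ofList (dup a (i - 1) H) = G' := by rw [hdupH, ← hUV]; rfl
  rw [hUV, ← hdupH, ← hdupW] at hGW'
  have hHW : Sylvester.Equiv H (P.toList ++ a :: S.toList) := by
    have := hGW'.del (a := a) (i := i - 1) (by rw [count_dup_self hHi]; omega)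
    rwa [del_dup _ _ _ hHi, del_dup _ _ _ hWi] at this
  have hHG := hGmax (FreeMonoid.ofList H) ((sylvCon_iff _ _).2 (by simpa using hHW))
    ((gathered_dup_iff hHi).1 (hGH ▸ hGg'))
  have hexp := hGmax' (FreeMonoid.ofList (dup a (i - 1) G.toList))
    ((sylvCon_iff _ _).2 (by simpa [hdupW] using hGW.dup a (i - 1)))
    ((gathered_dup_iff hGi).2 hGg)
  have hG_eq : FreeMonoid.ofList H = G := by
    refine hHG.resolve_right fun hlt => ?_
    have hlt : dup a (i - 1) H < dup a (i - 1) G.toList := lex_dup hlt (i - 1)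
    rw [← hGH] at hexp
    rcases hexp with h | h
    · exact hlt.ne' h
    · exact lt_asymm hlt h
  refine ⟨FreeMonoid.ofList U, FreeMonoid.ofList V, hU, ?_, ?_⟩
  · apply FreeMonoid.toList.injective
    simp [← hG_eq, hH]
  · apply FreeMonoid.toList.injective
    simp [hUV]
end

section
/- Let A be a finite totally ordered alphabet, let f be a 2-Chinese function on A with domain B ⊆ A, and let y ∈ A. Then the insertion f ← y is again a 2-Chinese function on A (with domain B ∪ {y}): it satisfies (f ← y)(x) ≤ x for every x in its domain, it is monotone, and its values lie in B ∪ {y}. -/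
/-- `f` is a 2-Chinese function on `A` with domain `B`: it maps `B` into `B`,
satisfies `f x ≤ x` on `B`, and is monotone on `B`. -/
def IsChinese2Fn {A : Type*} [LinearOrder A] (B : Finset A) (f : A → A) : Prop :=
  (∀ x ∈ B, f x ∈ B) ∧ (∀ x ∈ B, f x ≤ x) ∧
    (∀ x ∈ B, ∀ y ∈ B, x ≤ y → f x ≤ f y)

/-- The insertion `f ← y` of a letter `y` into a 2-Chinese function `f` with
domain `B`: its value at `x` is `min({y} ∪ {f x̂})` where `x̂ = min{z ∈ B : z ≥ x}`,
the set `{f x̂}` being empty (so the value is `y`) when no such `z` exists. -/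
noncomputable def chinese2Insert {A : Type*} [LinearOrder A]
    (B : Finset A) (f : A → A) (y : A) (x : A) : A :=
  if h : {z ∈ B | x ≤ z}.Nonempty then min y (f ({z ∈ B | x ≤ z}.min' h)) else y

theorem chinese2Insert_le {A : Type*} [LinearOrder A] (B : Finset A) (f : A → A) (y x : A) :
    chinese2Insert B f y x ≤ y := by
  unfold chinese2Insert
  split_ifs
  · exact min_le_left _ _
  · exact le_rfl

theorem chinese2Insert_of_mem {A : Type*} [LinearOrder A] {B : Finset A} (f : A → A) (y : A)
    {x : A} (hx : x ∈ B) : chinese2Insert B f y x = min y (f x) := by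
  have hmem : x ∈ {z ∈ B | x ≤ z} := Finset.mem_filter.2 ⟨hx, le_rfl⟩
  have hmin : {z ∈ B | x ≤ z}.min' ⟨x, hmem⟩ = x :=
    le_antisymm (Finset.min'_le _ _ hmem)
      (Finset.le_min' _ _ _ fun _ hz => (Finset.mem_filter.1 hz).2)
  rw [chinese2Insert, dif_pos ⟨x, hmem⟩, hmin]

theorem chinese2Insert_mem {A : Type*} [LinearOrder A] {B : Finset A} {f : A → A}
    (hf : ∀ x ∈ B, f x ∈ B) (y x : A) : chinese2Insert B f y x ∈ insert y B := by
  unfold chinese2Insert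
  split_ifs with h
  · rcases min_choice y (f ({z ∈ B | x ≤ z}.min' h)) with e | e <;> rw [e]
    · exact Finset.mem_insert_self _ _
    · exact Finset.mem_insert_of_mem (hf _ (Finset.mem_filter.1 (Finset.min'_mem _ h)).1)
  · exact Finset.mem_insert_self _ _

theorem chinese2Insert_monotone {A : Type*} [LinearOrder A] {B : Finset A} {f : A → A}
    (hf : ∀ x ∈ B, ∀ y ∈ B, x ≤ y → f x ≤ f y) (y : A) : Monotone (chinese2Insert B f y) := by
  intro a b hab
  by_cases hb : {z ∈ B | b ≤ z}.Nonempty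
  · have hsub : {z ∈ B | b ≤ z} ⊆ {z ∈ B | a ≤ z} :=
      Finset.monotone_filter_right B fun _ _ hz => hab.trans hz
    rw [chinese2Insert, chinese2Insert, dif_pos (hb.mono hsub), dif_pos hb]
    exact min_le_min_left y <| hf _ (Finset.mem_filter.1 (Finset.min'_mem _ _)).1 _
      (Finset.mem_filter.1 (Finset.min'_mem _ hb)).1 (Finset.min'_subset hb hsub)
  · calc chinese2Insert B f y a ≤ y := chinese2Insert_le B f y a
      _ = chinese2Insert B f y b := by rw [chinese2Insert, dif_neg hb]

/-- The insertion of a letter `y` into a 2-Chinese function on `A` with domain `B`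
is again a 2-Chinese function on `A`, with domain `B ∪ {y}`. -/
theorem chinese2Insert_isChinese2Fn {A : Type*} [LinearOrder A] [Fintype A]
    (B : Finset A) (f : A → A) (hf : IsChinese2Fn B f) (y : A) :
    IsChinese2Fn (insert y B) (chinese2Insert B f y) := by
  obtain ⟨hmem, hle, hmono⟩ := hf
  refine ⟨fun x _ => chinese2Insert_mem hmem y x, fun x hx => ?_,
    fun a _ b _ hab => chinese2Insert_monotone hmono y hab⟩
  rcases Finset.mem_insert.1 hx with rfl | hxB
  · exact chinese2Insert_le B f x x
  · rw [chinese2Insert_of_mem f y hxB]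
    exact (min_le_right _ _).trans (hle x hxB)
end

section
/- Let A be a finite totally ordered alphabet. The map sending a binary search tree T over A to the image of its right-to-left postfix reading R(T) in Sylv(A,2) restricts to a bijection from the set of 2-reduced binary search trees over A onto Sylv(A,2). Equivalently, every ≡_{Sylv(A,2)}-equivalence class of words over A contains the right-to-left postfix reading of exactly one 2-reduced binary search tree over A. -/
/-- Labelled binary trees over `A`. -/
inductive BTree (A : Type*) where
  | leaf : BTree A
  | node : BTree A → A → BTree A → BTree A

namespace BTree

/-- The right-to-left postfix reading of a binary tree:
`R(empty) = ε` and `R(node(L, r, R')) = R(R') · R(L) · r`. -/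
def reading {A : Type*} : BTree A → List A
  | leaf => []
  | node L r R => R.reading ++ L.reading ++ [r]

/-- A binary tree is a binary search tree if, at every node with label `r`,
all labels of the left subtree are `≤ r` and all labels of the right subtree
are `> r`. -/
def IsBST {A : Type*} [LinearOrder A] : BTree A → Prop
  | leaf => True
  | node L r R =>
      (∀ x ∈ L.reading, x ≤ r) ∧ (∀ x ∈ R.reading, r < x) ∧ IsBST L ∧ IsBST R

/-- The label of the root of a binary tree, if any. -/
def rootLabel? {A : Type*} : BTree A → Option A
  | leaf => none
  | node _ r _ => some r

/-- A binary tree is 2-reduced if no node has the same label as the root of its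
(nonempty) left subtree. -/
def IsReduced2 {A : Type*} [DecidableEq A] : BTree A → Prop
  | leaf => True
  | node L r R => L.rootLabel? ≠ some r ∧ IsReduced2 L ∧ IsReduced2 R

end BTree

/-- The defining relations of the 2-sylvester monoid: `a·c·W·b = c·a·W·b`
for all letters `a ≤ b < c` and all words `W`, together with `a² = a`
for every letter `a`. -/
def sylv2Rel {A : Type*} [LinearOrder A] (U V : FreeMonoid A) : Prop :=
  (∃ (a b c : A) (W : FreeMonoid A), a ≤ b ∧ b < c ∧
    U = FreeMonoid.of a * FreeMonoid.of c * W * FreeMonoid.of b ∧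
    V = FreeMonoid.of c * FreeMonoid.of a * W * FreeMonoid.of b) ∨
  (∃ a : A, U = FreeMonoid.of a * FreeMonoid.of a ∧ V = FreeMonoid.of a)

/-- The congruence on the free monoid defining the 2-sylvester monoid `Sylv(A, 2)`. -/
def sylv2Con (A : Type*) [LinearOrder A] : Con (FreeMonoid A) :=
  conGen sylv2Rel

namespace BTree

theorem rootLabel?_eq_none {A : Type*} {T : BTree A} : T.rootLabel? = none ↔ T = leaf := by
  cases T <;> simp [rootLabel?]

variable {A : Type*} [LinearOrder A]

/-- Leaf insertion into a binary search tree, leaving the tree unchanged when the new leaf would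
be the left child of a node with the same label. -/
def insertReduced (x : A) : BTree A → BTree A
  | leaf => node leaf x leaf
  | node L r R =>
      if x ≤ r then
        if x = r ∧ L.rootLabel? = none then node L r R else node (insertReduced x L) r R
      else node L r (insertReduced x R)

theorem rootLabel?_insertReduced (x : A) (T : BTree A) :
    (insertReduced x T).rootLabel? = some (T.rootLabel?.getD x) := by
  cases T with
  | leaf => rfl
  | node L r R => simp only [insertReduced]; split_ifs <;> rfl

theorem mem_reading_insertReduced (x y : A) (T : BTree A) :
    y ∈ (insertReduced x T).reading ↔ y = x ∨ y ∈ T.reading := by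
  induction T with
  | leaf => simp [insertReduced, reading]
  | node L r R ihL ihR =>
    simp only [insertReduced]
    split_ifs with h₁ h₂
    · simp only [reading, List.mem_append, List.mem_singleton, h₂.1]
      tauto
    · simp only [reading, List.mem_append, List.mem_singleton, ihL]
      tauto
    · simp only [reading, List.mem_append, List.mem_singleton, ihR]
      tauto

theorem IsBST.insertReduced (x : A) {T : BTree A} (hT : T.IsBST) :
    (insertReduced x T).IsBST := by
  induction T with
  | leaf => simp [BTree.insertReduced, IsBST, reading]
  | node L r R ihL ihR =>
    obtain ⟨hl, hr, hL, hR⟩ := hT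
    simp only [BTree.insertReduced]
    split_ifs with h₁ h₂
    · exact ⟨hl, hr, hL, hR⟩
    · refine ⟨fun y hy => ?_, hr, ihL hL, hR⟩
      rcases (mem_reading_insertReduced x y L).1 hy with rfl | hy
      exacts [h₁, hl y hy]
    · refine ⟨hl, fun y hy => ?_, hL, ihR hR⟩
      rcases (mem_reading_insertReduced x y R).1 hy with rfl | hy
      exacts [not_le.1 h₁, hr y hy]

theorem IsReduced2.insertReduced (x : A) {T : BTree A} (hT : T.IsReduced2) :
    (insertReduced x T).IsReduced2 := by
  induction T with
  | leaf => simp [BTree.insertReduced, IsReduced2, rootLabel?]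
  | node L r R ihL ihR =>
    obtain ⟨h, hL, hR⟩ := hT
    simp only [BTree.insertReduced]
    split_ifs with h₁ h₂
    · exact ⟨h, hL, hR⟩
    · refine ⟨?_, ihL hL, hR⟩
      rw [rootLabel?_insertReduced]
      cases hl : L.rootLabel? with
      | none => simpa [hl] using h₂
      | some s => simpa [hl] using h
    · exact ⟨h, hL, ihR hR⟩

theorem insertReduced_idem (x : A) (T : BTree A) :
    insertReduced x (insertReduced x T) = insertReduced x T := by
  induction T with
  | leaf => simp [insertReduced, rootLabel?]
  | node L r R ihL ihR =>
    by_cases h₁ : x ≤ r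
    · by_cases h₂ : x = r ∧ L.rootLabel? = none
      · simp [insertReduced, h₂]
      · simp [insertReduced, h₁, h₂, rootLabel?_insertReduced, ihL]
    · simp [insertReduced, h₁, ihR]

/-- Insertions of `a` and `c` commute in a binary search tree that has a label separating them. -/
theorem IsBST.insertReduced_comm {a b c : A} (hab : a ≤ b) (hbc : b < c) {T : BTree A}
    (hT : T.IsBST) (hb : b ∈ T.reading) :
    BTree.insertReduced a (BTree.insertReduced c T) =
      BTree.insertReduced c (BTree.insertReduced a T) := by
  induction T with
  | leaf => simp [reading] at hb
  | node L r R ihL ihR =>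
    obtain ⟨hl, hr, hL, hR⟩ := hT
    simp only [reading, List.mem_append, List.mem_singleton] at hb
    by_cases hc : c ≤ r
    · have hbL : b ∈ L.reading := by
        rcases hb with (hb | hb) | hb
        · exact absurd (hr b hb) (not_lt.2 (hbc.le.trans hc))
        · exact hb
        · exact absurd hbc (not_lt.2 (hb ▸ hc))
      have har : a < r := (hab.trans_lt hbc).trans_le hc
      have hne : L.rootLabel? ≠ none := by
        rw [Ne, rootLabel?_eq_none]
        rintro rfl
        simp [reading] at hbL
      simp [BTree.insertReduced, hc, har.le, har.ne, hne, rootLabel?_insertReduced, ihL hL hbL]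
    · by_cases ha : a ≤ r
      · by_cases h₂ : a = r ∧ L.rootLabel? = none
        · obtain ⟨rfl, h₂⟩ := h₂
          simp [BTree.insertReduced, hc, h₂]
        · simp [BTree.insertReduced, hc, ha, h₂]
      · have hbR : b ∈ R.reading := by
          rcases hb with (hb | hb) | hb
          · exact hb
          · exact absurd (hab.trans (hl b hb)) ha
          · exact absurd (hb ▸ hab) ha
        simp [BTree.insertReduced, hc, ha, ihR hR hbR]

theorem IsBST.foldr_insertReduced (w : List A) {T : BTree A} (hT : T.IsBST) :
    (w.foldr BTree.insertReduced T).IsBST := by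
  induction w with
  | nil => exact hT
  | cons x w ih => exact ih.insertReduced x

theorem IsReduced2.foldr_insertReduced (w : List A) {T : BTree A} (hT : T.IsReduced2) :
    (w.foldr BTree.insertReduced T).IsReduced2 := by
  induction w with
  | nil => exact hT
  | cons x w ih => exact ih.insertReduced x

theorem mem_reading_foldr_insertReduced (w : List A) {T : BTree A} {y : A} (hy : y ∈ T.reading) :
    y ∈ (w.foldr insertReduced T).reading := by
  induction w with
  | nil => exact hy
  | cons x w ih => exact (mem_reading_insertReduced x y _).2 (Or.inr ih)

theorem foldr_insertReduced_node_left {w : List A} {r : A} (hw : ∀ x ∈ w, x ≤ r) {L : BTree A}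
    (hL : L.rootLabel? ≠ none) (R : BTree A) :
    w.foldr insertReduced (node L r R) = node (w.foldr insertReduced L) r R := by
  induction w with
  | nil => rfl
  | cons x w ih =>
    simp only [List.forall_mem_cons] at hw
    have hne : (w.foldr insertReduced L).rootLabel? ≠ none := by
      cases w with
      | nil => exact hL
      | cons y w => simp [rootLabel?_insertReduced]
    simp [ih hw.2, insertReduced, hw.1, hne]

theorem foldr_insertReduced_node_right {w : List A} {r : A} (hw : ∀ x ∈ w, r < x)
    (L R : BTree A) :
    w.foldr insertReduced (node L r R) = node L r (w.foldr insertReduced R) := by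
  induction w with
  | nil => rfl
  | cons x w ih =>
    simp only [List.forall_mem_cons] at hw
    simp [ih hw.2, insertReduced, hw.1]

/-- A 2-reduced binary search tree is recovered by inserting its reading from right to left. -/
theorem foldr_insertReduced_reading {T : BTree A} (hT : T.IsBST) (hT₂ : T.IsReduced2) :
    T.reading.foldr insertReduced leaf = T := by
  induction T with
  | leaf => rfl
  | node L r R ihL ihR =>
    obtain ⟨hl, hr, hL, hR⟩ := hT
    obtain ⟨h, hL₂, hR₂⟩ := hT₂
    have key : L.reading.foldr insertReduced (node leaf r leaf) = node L r leaf := by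
      cases L with
      | leaf => rfl
      | node L' s R' =>
        have hsr : s ≠ r := fun e => h (congrArg some e)
        have hs : s ≤ r := hl s (by simp [reading])
        have := ihL hL hL₂
        simp only [reading, List.foldr_append, List.foldr_cons, List.foldr_nil] at this ⊢
        rw [show insertReduced s (node leaf r leaf) = node (insertReduced s leaf) r leaf by
          simp [insertReduced, hs, hsr]]
        rw [← List.foldr_append] at this ⊢
        rw [foldr_insertReduced_node_left _ (by simp [rootLabel?_insertReduced]), this]
        exact fun x hx => hl x (by simp only [reading, List.mem_append] at hx ⊢; exact Or.inl hx)
    simp only [reading, List.foldr_append, List.foldr_cons, List.foldr_nil]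
    rw [insertReduced, key, foldr_insertReduced_node_right hr, ihR hR hR₂]

/-- Congruent words act in the same way on binary search trees by right-to-left insertion. -/
theorem foldr_insertReduced_eq_of_sylv2Con {u v : FreeMonoid A} (h : sylv2Con A u v)
    {T : BTree A} (hT : T.IsBST) :
    u.toList.foldr insertReduced T = v.toList.foldr insertReduced T := by
  replace h : ConGen.Rel sylv2Rel u v := h
  induction h generalizing T with
  | of u v h =>
    rcases h with ⟨a, b, c, W, hab, hbc, rfl, rfl⟩ | ⟨a, rfl, rfl⟩
    · simp only [FreeMonoid.toList_mul, FreeMonoid.toList_of, List.foldr_append, List.foldr_cons,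
        List.foldr_nil]
      exact ((hT.insertReduced b).foldr_insertReduced _).insertReduced_comm hab hbc
        (mem_reading_foldr_insertReduced _ ((mem_reading_insertReduced b b T).2 (Or.inl rfl)))
    · simp only [FreeMonoid.toList_mul, FreeMonoid.toList_of, List.foldr_append, List.foldr_cons,
        List.foldr_nil]
      exact insertReduced_idem a T
  | refl => rfl
  | symm _ ih => exact (ih hT).symm
  | trans _ _ ih₁ ih₂ => exact (ih₁ hT).trans (ih₂ hT)
  | mul _ _ ih₁ ih₂ =>
    rw [FreeMonoid.toList_mul, FreeMonoid.toList_mul, List.foldr_append, List.foldr_append,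
      ih₂ hT]
    exact ih₁ (hT.foldr_insertReduced _)

end BTree

section Sylv2

open FreeMonoid

variable {A : Type*} [LinearOrder A]

theorem sylv2Con_of_rel {u v : FreeMonoid A} (h : sylv2Rel u v) : sylv2Con A u v :=
  ConGen.Rel.of u v h

/-- A letter moves past a word of larger letters, in the presence of a separating letter further
to the right. -/
theorem sylv2Con_of_mul_comm {a b : A} (hab : a ≤ b) (W : FreeMonoid A) {w : List A}
    (hw : ∀ c ∈ w, b < c) :
    sylv2Con A (of a * ofList w * W * of b) (ofList w * of a * W * of b) := by
  induction w with
  | nil => exact (sylv2Con A).refl _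
  | cons c w ih =>
    simp only [List.forall_mem_cons] at hw
    have h₁ := sylv2Con_of_rel (Or.inl ⟨a, b, c, ofList w * W, hab, hw.1, rfl, rfl⟩)
    have h₂ := (sylv2Con A).mul ((sylv2Con A).refl (of c)) (ih hw.2)
    rw [ofList_cons]
    simp only [mul_assoc] at h₁ h₂ ⊢
    exact (sylv2Con A).trans h₁ h₂

theorem sylv2Con_reading_insertReduced (x : A) {T : BTree A} (hT : T.IsBST) :
    sylv2Con A (of x * ofList T.reading) (ofList (BTree.insertReduced x T).reading) := by
  induction T with
  | leaf => exact (sylv2Con A).refl _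
  | node L r R ihL ihR =>
    obtain ⟨hl, hr, hL, hR⟩ := hT
    simp only [BTree.insertReduced]
    split_ifs with h₁ h₂
    · obtain ⟨rfl, h₂⟩ := h₂
      obtain rfl := BTree.rootLabel?_eq_none.1 h₂
      have h₃ := sylv2Con_of_mul_comm le_rfl 1 hr
      have h₄ := (sylv2Con A).mul ((sylv2Con A).refl (ofList R.reading))
        (sylv2Con_of_rel (Or.inr ⟨x, rfl, rfl⟩))
      simp only [BTree.reading, ofList_append, ofList_singleton, ofList_nil, mul_one,
        mul_assoc] at h₃ h₄ ⊢
      exact (sylv2Con A).trans h₃ h₄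
    · have h₃ := sylv2Con_of_mul_comm h₁ (ofList L.reading) hr
      have h₄ := (sylv2Con A).mul ((sylv2Con A).mul ((sylv2Con A).refl (ofList R.reading))
        (ihL hL)) ((sylv2Con A).refl (of r))
      simp only [BTree.reading, ofList_append, ofList_singleton, mul_assoc] at h₃ h₄ ⊢
      exact (sylv2Con A).trans h₃ h₄
    · have h₃ := (sylv2Con A).mul (ihR hR) ((sylv2Con A).refl (ofList L.reading * of r))
      simpa only [BTree.reading, ofList_append, ofList_singleton, mul_assoc] using h₃

theorem sylv2Con_reading_foldr_insertReduced (w : List A) :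
    sylv2Con A (ofList (w.foldr BTree.insertReduced BTree.leaf).reading) (ofList w) := by
  induction w with
  | nil => exact (sylv2Con A).refl _
  | cons x w ih =>
    rw [ofList_cons]
    exact (sylv2Con A).trans
      ((sylv2Con A).symm (sylv2Con_reading_insertReduced x (.foldr_insertReduced w trivial)))
      ((sylv2Con A).mul ((sylv2Con A).refl _) ih)

end Sylv2

/-- The map sending a 2-reduced binary search tree over `A` to the image in
`Sylv(A, 2)` of its right-to-left postfix reading is a bijection onto `Sylv(A, 2)`:
every `≡_{Sylv(A,2)}`-class contains the reading of exactly one 2-reduced binary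
search tree. -/
theorem sylv2_bst_normal_forms {A : Type*} [LinearOrder A] [Fintype A] :
    Function.Bijective
      (fun T : {T : BTree A // T.IsBST ∧ T.IsReduced2} =>
        (sylv2Con A).mk' (FreeMonoid.ofList T.1.reading)) := by
  constructor
  · rintro ⟨S, hS, hS₂⟩ ⟨T, hT, hT₂⟩ h
    have hc : sylv2Con A (FreeMonoid.ofList S.reading) (FreeMonoid.ofList T.reading) :=
      (Con.eq _).1 h
    have := BTree.foldr_insertReduced_eq_of_sylv2Con hc (T := BTree.leaf) trivial
    rw [FreeMonoid.toList_ofList, FreeMonoid.toList_ofList,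
      BTree.foldr_insertReduced_reading hS hS₂, BTree.foldr_insertReduced_reading hT hT₂] at this
    exact Subtype.ext this
  · intro q
    obtain ⟨w, rfl⟩ := Con.mk'_surjective q
    exact ⟨⟨w.toList.foldr BTree.insertReduced BTree.leaf, .foldr_insertReduced _ trivial,
      .foldr_insertReduced _ trivial⟩,
      (Con.eq _).2 (sylv2Con_reading_foldr_insertReduced w.toList)⟩
end

section
/- Let A be a finite totally ordered alphabet. An element of Sylv(A,2) is idempotent if and only if it is the image of the right-to-left postfix reading R(T) of a 2-reduced binary search tree T over A such that, for every letter x occurring in T, the node of maximal depth among the nodes of T labelled x has an empty left subtree. -/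
namespace BTree

/-- `S` is a subtree of `T` (i.e. `S` is the subtree rooted at some node of `T`,
or the empty tree). -/
def IsSubtree {A : Type*} (S : BTree A) : BTree A → Prop
  | leaf => S = leaf
  | node L r R => S = node L r R ∨ IsSubtree S L ∨ IsSubtree S R

/-- In a binary search tree, the nodes carrying a given label `x` form a chain
under the ancestor relation, and the node of maximal depth labelled `x` is
precisely the node labelled `x` none of whose descendants is labelled `x`.
This predicate says: for every letter `x` occurring in `T`, the node of maximal
depth labelled `x` has an empty left subtree. -/
def DeepestLeftEmpty {A : Type*} [DecidableEq A] (T : BTree A) : Prop :=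
  ∀ (L : BTree A) (x : A) (R : BTree A),
    IsSubtree (node L x R) T → x ∉ L.reading → x ∉ R.reading → L = leaf

end BTree

namespace BTree

variable {A : Type*}

/-- The number of nodes of a binary tree. -/
def size : BTree A → ℕ
  | leaf => 0
  | node L _ R => L.size + R.size + 1

theorem mem_reading_of_isSubtree {L R T : BTree A} {x : A} (h : IsSubtree (node L x R) T) :
    x ∈ T.reading := by
  induction T with
  | leaf => simp [IsSubtree] at h
  | node L' r R' ihL ihR =>
    rcases h with h | h | h
    · cases h
      simp [reading]
    · simp [reading, ihL h]
    · simp [reading, ihR h]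

variable [LinearOrder A]

open Classical in
/-- Insertion of a letter in a 2-reduced binary search tree: insertion as a leaf, except that
nothing happens when the new leaf would be the left child of a node with the same label. -/
noncomputable def insert (x : A) : BTree A → BTree A
  | leaf => node leaf x leaf
  | node L r R =>
      if r < x then node L r (insert x R)
      else if x = r ∧ L = leaf then node L r R
      else node (insert x L) r R

theorem insert_of_lt {x r : A} (L R : BTree A) (h : r < x) :
    insert x (node L r R) = node L r (insert x R) := by
  simp [insert, h]

theorem insert_root_of_leaf (r : A) (R : BTree A) :
    insert r (node leaf r R) = node leaf r R := by
  simp [insert]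

theorem insert_of_le {x r : A} {L : BTree A} (R : BTree A) (h : x ≤ r)
    (h' : ¬(x = r ∧ L = leaf)) : insert x (node L r R) = node (insert x L) r R := by
  simp only [insert, not_lt.mpr h, h', if_false]

/-- The three cases in the insertion of a letter at a node. -/
theorem insert_cases (x r : A) (L : BTree A) :
    r < x ∨ (x = r ∧ L = leaf) ∨ (x ≤ r ∧ ¬(x = r ∧ L = leaf)) := by
  rcases lt_or_ge r x with h | h
  · exact Or.inl h
  · exact Or.inr ((em _).imp_right fun h' => ⟨h, h'⟩)

theorem insert_ne_leaf (x : A) (T : BTree A) : insert x T ≠ leaf := by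
  cases T with
  | leaf => simp [insert]
  | node L r R =>
    unfold insert
    split_ifs <;> simp

theorem mem_reading_insert {x y : A} {T : BTree A} :
    y ∈ (insert x T).reading ↔ y = x ∨ y ∈ T.reading := by
  induction T with
  | leaf => simp [insert, reading]
  | node L r R ihL ihR =>
    rcases insert_cases x r L with h | ⟨rfl, rfl⟩ | ⟨h, h'⟩
    · simp only [insert_of_lt _ _ h, reading, List.mem_append, ihR]
      tauto
    · simp only [insert_root_of_leaf, reading, List.mem_append, List.mem_singleton]
      tauto
    · simp only [insert_of_le _ h h', reading, List.mem_append, ihL]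
      tauto

theorem IsBST.insert {T : BTree A} (hT : T.IsBST) (x : A) : (insert x T).IsBST := by
  induction T with
  | leaf => simp [BTree.insert, IsBST, reading]
  | node L r R ihL ihR =>
    obtain ⟨hL, hR, bL, bR⟩ := hT
    rcases insert_cases x r L with h | ⟨rfl, rfl⟩ | ⟨h, h'⟩
    · rw [insert_of_lt _ _ h]
      refine ⟨hL, fun y hy => ?_, bL, ihR bR⟩
      rcases mem_reading_insert.mp hy with rfl | hy
      exacts [h, hR y hy]
    · rw [insert_root_of_leaf]
      exact ⟨hL, hR, bL, bR⟩
    · rw [insert_of_le _ h h']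
      refine ⟨fun y hy => ?_, hR, ihL bL, bR⟩
      rcases mem_reading_insert.mp hy with rfl | hy
      exacts [h, hL y hy]

theorem rootLabel?_insert {x : A} {T : BTree A} (hT : T ≠ leaf) :
    (insert x T).rootLabel? = T.rootLabel? := by
  cases T with
  | leaf => exact absurd rfl hT
  | node L r R =>
    unfold insert
    split_ifs <;> rfl

theorem IsReduced2.insert {T : BTree A} (hT : T.IsReduced2) (x : A) :
    (insert x T).IsReduced2 := by
  induction T with
  | leaf => simp [BTree.insert, IsReduced2, rootLabel?]
  | node L r R ihL ihR =>
    obtain ⟨hL, rL, rR⟩ := hT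
    rcases insert_cases x r L with h | ⟨rfl, rfl⟩ | ⟨h, h'⟩
    · rw [insert_of_lt _ _ h]
      exact ⟨hL, rL, ihR rR⟩
    · rw [insert_root_of_leaf]
      exact ⟨hL, rL, rR⟩
    · rw [insert_of_le _ h h']
      refine ⟨?_, ihL rL, rR⟩
      by_cases hl : L = leaf
      · subst hl
        simpa [BTree.insert, rootLabel?] using h'
      · rwa [rootLabel?_insert hl]

theorem insert_insert_self (x : A) (T : BTree A) : insert x (insert x T) = insert x T := by
  induction T with
  | leaf => exact insert_root_of_leaf x leaf
  | node L r R ihL ihR =>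
    rcases insert_cases x r L with h | ⟨rfl, rfl⟩ | ⟨h, h'⟩
    · rw [insert_of_lt _ _ h, insert_of_lt _ _ h, ihR]
    · rw [insert_root_of_leaf, insert_root_of_leaf]
    · rw [insert_of_le _ h h', insert_of_le _ h fun hl => insert_ne_leaf x L hl.2, ihL]

theorem insert_comm {a b c : A} (hab : a ≤ b) (hbc : b < c) {T : BTree A} (hT : T.IsBST)
    (hb : b ∈ T.reading) : insert a (insert c T) = insert c (insert a T) := by
  induction T with
  | leaf => simp [reading] at hb
  | node L r R ihL ihR =>
    obtain ⟨hL, hR, bL, bR⟩ := hT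
    simp only [reading, List.mem_append, List.mem_singleton] at hb
    rcases lt_or_ge r a with hra | har
    · have hbR : b ∈ R.reading := by
        rcases hb with (hb | hb) | hb
        · exact hb
        · exact absurd (hL b hb) (not_le.mpr (hra.trans_le hab))
        · exact absurd hb (hra.trans_le hab).ne'
      have hrc : r < c := (hra.trans_le hab).trans hbc
      rw [insert_of_lt _ _ hrc, insert_of_lt _ _ hra, insert_of_lt _ _ hra,
        insert_of_lt _ _ hrc, ihR bR hbR]
    rcases lt_or_ge r c with hrc | hcr
    · rw [insert_of_lt _ _ hrc]
      by_cases ha : a = r ∧ L = leaf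
      · obtain ⟨rfl, rfl⟩ := ha
        rw [insert_root_of_leaf, insert_root_of_leaf, insert_of_lt _ _ hrc]
      · rw [insert_of_le _ har ha, insert_of_le _ har ha, insert_of_lt _ _ hrc]
    · have hbL : b ∈ L.reading := by
        rcases hb with (hb | hb) | hb
        · exact absurd (hR b hb) (not_lt.mpr (hbc.le.trans hcr))
        · exact hb
        · exact absurd hb (hbc.trans_le hcr).ne
      have hl : L ≠ leaf := by
        rintro rfl
        simp [reading] at hbL
      rw [insert_of_le _ hcr fun h => hl h.2, insert_of_le _ har fun h => hl h.2,
        insert_of_le _ har fun h => insert_ne_leaf _ _ h.2,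
        insert_of_le _ hcr fun h => insert_ne_leaf _ _ h.2, ihL bL hbL]

theorem insert_eq_or_size_lt (x : A) (T : BTree A) :
    insert x T = T ∨ T.size < (insert x T).size := by
  induction T with
  | leaf => simp [insert, size]
  | node L r R ihL ihR =>
    rcases insert_cases x r L with h | ⟨rfl, rfl⟩ | ⟨h, h'⟩
    · rw [insert_of_lt _ _ h]
      exact ihR.imp (fun e => by rw [e]) fun e => by simpa [size] using e
    · exact Or.inl (insert_root_of_leaf _ _)
    · rw [insert_of_le _ h h']
      exact ihL.imp (fun e => by rw [e]) fun e => by simpa [size] using e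

theorem left_eq_leaf_of_insert_eq_self {x : A} {T L R : BTree A} (hT : T.IsBST)
    (h : insert x T = T) (hs : IsSubtree (node L x R) T) (hx : x ∉ L.reading) : L = leaf := by
  induction T with
  | leaf => simp [IsSubtree] at hs
  | node L' r R' ihL ihR =>
    obtain ⟨hL, hR, bL, bR⟩ := hT
    rcases insert_cases x r L' with hr | ⟨rfl, rfl⟩ | ⟨hr, hr'⟩
    · rw [insert_of_lt _ _ hr] at h
      rcases hs with hs | hs | hs
      · cases hs
        exact absurd hr (lt_irrefl _)
      · exact absurd (hL x (mem_reading_of_isSubtree hs)) (not_le.mpr hr)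
      · exact ihR bR (by injection h) hs
    · rcases hs with hs | hs | hs
      · cases hs
        rfl
      · simp [IsSubtree] at hs
      · exact absurd (hR x (mem_reading_of_isSubtree hs)) (lt_irrefl _)
    · rw [insert_of_le _ hr hr'] at h
      have h' : insert x L' = L' := by injection h
      rcases hs with hs | hs | hs
      · cases hs
        exact absurd (h' ▸ mem_reading_insert.mpr (Or.inl rfl)) hx
      · exact ihL bL h' hs
      · exact absurd (hR x (mem_reading_of_isSubtree hs)) (not_lt.mpr hr)

theorem insert_eq_self_of_deepest {x : A} {T : BTree A} (hT : T.IsBST) (hx : x ∈ T.reading)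
    (h : ∀ L R, IsSubtree (node L x R) T → x ∉ L.reading → x ∉ R.reading → L = leaf) :
    insert x T = T := by
  induction T with
  | leaf => simp [reading] at hx
  | node L r R ihL ihR =>
    obtain ⟨hL, hR, bL, bR⟩ := hT
    simp only [reading, List.mem_append, List.mem_singleton] at hx
    rcases insert_cases x r L with hr | ⟨rfl, rfl⟩ | ⟨hr, hr'⟩
    · have hxR : x ∈ R.reading := by
        rcases hx with (hx | hx) | hx
        · exact hx
        · exact absurd (hL x hx) (not_le.mpr hr)
        · exact absurd hx hr.ne'
      rw [insert_of_lt _ _ hr, ihR bR hxR fun L' R' hs => h L' R' (Or.inr (Or.inr hs))]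
    · exact insert_root_of_leaf _ _
    · have hxR : x ∉ R.reading := fun hx => not_lt.mpr hr (hR x hx)
      have hxL : x ∈ L.reading := by
        by_contra hxL
        have hxr : x = r := by tauto
        subst hxr
        exact hr' ⟨rfl, h L R (Or.inl rfl) hxL hxR⟩
      rw [insert_of_le _ hr hr', ihL bL hxL fun L' R' hs => h L' R' (Or.inr (Or.inl hs))]

theorem deepestLeftEmpty_iff {T : BTree A} (hT : T.IsBST) :
    T.DeepestLeftEmpty ↔ ∀ x ∈ T.reading, insert x T = T :=
  ⟨fun h x hx => insert_eq_self_of_deepest hT hx fun L R => h L x R,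
    fun h _ x _ hs hL _ =>
      left_eq_leaf_of_insert_eq_self hT (h x (mem_reading_of_isSubtree hs)) hs hL⟩

/-- Successive insertion of the letters of a word, from right to left. -/
noncomputable def insertWord (w : List A) (T : BTree A) : BTree A :=
  w.foldr insert T

@[simp]
theorem insertWord_nil (T : BTree A) : insertWord [] T = T := rfl

@[simp]
theorem insertWord_cons (x : A) (w : List A) (T : BTree A) :
    insertWord (x :: w) T = insert x (insertWord w T) := rfl

theorem insertWord_append (v w : List A) (T : BTree A) :
    insertWord (v ++ w) T = insertWord v (insertWord w T) :=
  List.foldr_append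

theorem IsBST.insertWord {T : BTree A} (hT : T.IsBST) (w : List A) : (insertWord w T).IsBST := by
  induction w with
  | nil => exact hT
  | cons x w ih => exact ih.insert x

theorem IsReduced2.insertWord {T : BTree A} (hT : T.IsReduced2) (w : List A) :
    (insertWord w T).IsReduced2 := by
  induction w with
  | nil => exact hT
  | cons x w ih => exact ih.insert x

theorem mem_reading_insertWord {y : A} {w : List A} {T : BTree A} :
    y ∈ (insertWord w T).reading ↔ y ∈ w ∨ y ∈ T.reading := by
  induction w with
  | nil => simp
  | cons x w ih => simp [mem_reading_insert, ih, or_assoc]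

theorem size_le_size_insertWord (w : List A) (T : BTree A) : T.size ≤ (insertWord w T).size := by
  induction w with
  | nil => rfl
  | cons x w ih =>
    rcases insert_eq_or_size_lt x (insertWord w T) with h | h
    · rwa [insertWord_cons, h]
    · exact ih.trans h.le

theorem insert_eq_self_of_insertWord_eq_self {w : List A} {T : BTree A}
    (h : insertWord w T = T) : ∀ x ∈ w, insert x T = T := by
  induction w with
  | nil => simp
  | cons x w ih =>
    rw [insertWord_cons] at h
    have hw : insertWord w T = T := by
      rcases insert_eq_or_size_lt x (insertWord w T) with h' | h'
      · rw [← h', h]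
      · rw [h] at h'
        exact absurd h' (not_lt.mpr (size_le_size_insertWord w T))
    rw [hw] at h
    simpa [h] using ih hw

/-- The congruence of words which act in the same way on binary search trees. -/
def insertCon (A : Type*) [LinearOrder A] : Con (FreeMonoid A) where
  r U V := ∀ T : BTree A, T.IsBST → insertWord U.toList T = insertWord V.toList T
  iseqv := ⟨fun _ _ _ => rfl, fun h T hT => (h T hT).symm,
    fun h h' T hT => (h T hT).trans (h' T hT)⟩
  mul' {U U' V V'} h h' T hT := by
    rw [FreeMonoid.toList_mul, FreeMonoid.toList_mul, insertWord_append, insertWord_append,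
      h' T hT, h _ (hT.insertWord _)]

theorem sylv2Con_le_insertCon : sylv2Con A ≤ insertCon A := by
  refine Con.conGen_le.mpr ?_
  rintro U V (⟨a, b, c, W, hab, hbc, rfl, rfl⟩ | ⟨a, rfl, rfl⟩) T hT
  · simp only [FreeMonoid.toList_mul, FreeMonoid.toList_of, List.append_assoc,
      List.singleton_append]
    exact insert_comm hab hbc (hT.insertWord _) (mem_reading_insertWord.mpr (by simp))
  · simp only [FreeMonoid.toList_mul, FreeMonoid.toList_of, List.singleton_append,
      insertWord_cons, insertWord_nil]
    exact insert_insert_self a T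

end BTree

section Quotient

open BTree

variable {A : Type*} [LinearOrder A]

/-- The image of a word in the 2-sylvester monoid. -/
def sylv2Class (w : List A) : (sylv2Con A).Quotient :=
  (sylv2Con A).mk' (FreeMonoid.ofList w)

theorem sylv2Class_append (v w : List A) :
    sylv2Class (v ++ w) = sylv2Class v * sylv2Class w := by
  simp [sylv2Class, FreeMonoid.ofList_append]

theorem sylv2Class_cons (x : A) (w : List A) :
    sylv2Class (x :: w) = sylv2Class [x] * sylv2Class w :=
  sylv2Class_append [x] w

theorem sylv2Class_pair_self (a : A) : sylv2Class [a, a] = sylv2Class [a] :=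
  (Con.eq _).mpr (ConGen.Rel.of _ _ (Or.inr ⟨a, rfl, rfl⟩))

theorem sylv2Class_swap {a b c : A} (hab : a ≤ b) (hbc : b < c) (W : List A) :
    sylv2Class (a :: c :: (W ++ [b])) = sylv2Class (c :: a :: (W ++ [b])) :=
  (Con.eq _).mpr (ConGen.Rel.of _ _ (Or.inl ⟨a, b, c, FreeMonoid.ofList W, hab, hbc, rfl, rfl⟩))

theorem sylv2Class_cons_append {x r : A} (hx : x ≤ r) {v : List A} (hv : ∀ y ∈ v, r < y)
    (W : List A) :
    sylv2Class (x :: (v ++ (W ++ [r]))) = sylv2Class (v ++ (x :: (W ++ [r]))) := by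
  induction v with
  | nil => rfl
  | cons y v ih =>
    rw [List.forall_mem_cons] at hv
    have hs := sylv2Class_swap hx hv.1 (v ++ W)
    rw [List.append_assoc] at hs
    rw [List.cons_append, hs, sylv2Class_cons, ih hv.2, ← sylv2Class_cons, List.cons_append]

theorem sylv2Class_reading_insert (x : A) {T : BTree A} (hT : T.IsBST) :
    sylv2Class (insert x T).reading = sylv2Class [x] * sylv2Class T.reading := by
  rw [← sylv2Class_cons]
  induction T with
  | leaf => rfl
  | node L r R ihL ihR =>
    obtain ⟨hL, hR, bL, bR⟩ := hT
    rcases insert_cases x r L with h | ⟨rfl, rfl⟩ | ⟨h, h'⟩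
    · rw [insert_of_lt _ _ h, reading, reading, List.append_assoc, List.append_assoc,
        sylv2Class_append, ihR bR, ← sylv2Class_append, List.cons_append]
    · have hm := sylv2Class_cons_append le_rfl hR []
      simp only [List.nil_append] at hm
      rw [insert_root_of_leaf, reading, reading, List.append_nil, hm, sylv2Class_append,
        sylv2Class_append, sylv2Class_pair_self]
    · rw [insert_of_le _ h h', reading, reading, List.append_assoc, List.append_assoc,
        sylv2Class_cons_append h hR, sylv2Class_append, sylv2Class_append, ihL bL,
        ← sylv2Class_append, ← sylv2Class_append, List.cons_append]

theorem sylv2Class_reading_insertWord (w : List A) {T : BTree A} (hT : T.IsBST) :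
    sylv2Class (insertWord w T).reading = sylv2Class w * sylv2Class T.reading := by
  induction w with
  | nil => exact (one_mul _).symm
  | cons x w ih =>
    rw [insertWord_cons, sylv2Class_reading_insert x (hT.insertWord w), ih, ← mul_assoc,
      ← sylv2Class_cons]

theorem insertWord_eq_of_sylv2Class_eq {v w : List A} (h : sylv2Class v = sylv2Class w)
    {T : BTree A} (hT : T.IsBST) : insertWord v T = insertWord w T :=
  sylv2Con_le_insertCon ((Con.eq _).mp h) T hT

theorem sylv2Class_mul_reading {T : BTree A} (hT : T.IsBST) {w : List A}
    (h : ∀ x ∈ w, insert x T = T) :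
    sylv2Class w * sylv2Class T.reading = sylv2Class T.reading := by
  induction w with
  | nil => exact one_mul _
  | cons x w ih =>
    rw [List.forall_mem_cons] at h
    rw [sylv2Class_cons, mul_assoc, ih h.2, ← sylv2Class_reading_insert x hT, h.1]

end Quotient

/-- An element of `Sylv(A, 2)` is idempotent if and only if it is the image of the
right-to-left postfix reading of a 2-reduced binary search tree in which, for every
letter `x` occurring in the tree, the node of maximal depth labelled `x` has an
empty left subtree. -/
theorem sylv2_idempotents {A : Type*} [LinearOrder A] [Fintype A]
    (q : (sylv2Con A).Quotient) :
    q * q = q ↔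
      ∃ T : BTree A, T.IsBST ∧ T.IsReduced2 ∧ T.DeepestLeftEmpty ∧
        q = (sylv2Con A).mk' (FreeMonoid.ofList T.reading) := by
  constructor
  · obtain ⟨w, rfl⟩ : ∃ w : List A, sylv2Class w = q := Con.mk'_surjective q
    intro h
    have hT : (BTree.insertWord w BTree.leaf).IsBST :=
      BTree.IsBST.insertWord (T := BTree.leaf) trivial w
    refine ⟨BTree.insertWord w BTree.leaf, hT,
      BTree.IsReduced2.insertWord (T := BTree.leaf) trivial w, ?_, ?_⟩
    · rw [BTree.deepestLeftEmpty_iff hT]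
      intro x hx
      rw [← sylv2Class_append] at h
      have hw := insertWord_eq_of_sylv2Class_eq h (T := BTree.leaf) trivial
      rw [BTree.insertWord_append] at hw
      refine BTree.insert_eq_self_of_insertWord_eq_self hw x ?_
      simpa [BTree.reading] using BTree.mem_reading_insertWord.mp hx
    · exact ((sylv2Class_reading_insertWord w (T := BTree.leaf) trivial).trans
        (mul_one _)).symm
  · rintro ⟨T, hT, -, hd, rfl⟩
    exact sylv2Class_mul_reading hT ((BTree.deepestLeftEmpty_iff hT).mp hd)
end
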